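/- Let P ⊂ ℝ^n be a full-dimensional lattice polytope, i.e. the convex hull of a finite set of points of ℤ^n whose affine span is ℝ^n. Then there exists a single polynomial p ∈ ℝ[T] of degree n with leading coefficient equal to the Lebesgue measure vol(P) such that #(tP ∩ ℤ^n) = p(t) for every positive integer t. -/

import Mathlib

open MeasureTheory Pointwise

theorem IsCompact.exists_toLex_max {m : ℕ} {A : Set (Fin m → ℝ)} (hA : IsCompact A)
    (hne : A.Nonempty) : ∃ c ∈ A, ∀ c' ∈ A, toLex c' ≤ toLex c := by
  induction m with
  | zero =>
    obtain ⟨c, hc⟩ := hne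
    exact ⟨c, hc, fun c' _ => (congrArg toLex (Subsingleton.elim c' c)).le⟩
  | succ m ih =>
    obtain ⟨a, haA, ha⟩ := hA.exists_isMaxOn hne (continuous_apply 0).continuousOn
    have hcomp : IsCompact ((fun c : Fin (m + 1) → ℝ => Fin.tail c) '' (A ∩ {c | c 0 = a 0})) := by
      refine (hA.inter_right (isClosed_eq (continuous_apply 0) continuous_const)).image ?_
      exact continuous_pi fun i => continuous_apply i.succ
    obtain ⟨-, ⟨b, ⟨hbA, hb0⟩, rfl⟩, hb⟩ := ih hcomp ⟨_, a, ⟨haA, rfl⟩, rfl⟩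
    refine ⟨b, hbA, fun c hc => ?_⟩
    have hb0 : b 0 = a 0 := hb0
    have hle : c 0 ≤ b 0 := hb0 ▸ ha hc
    rcases hle.lt_or_eq with hlt | heq
    · exact le_of_lt ⟨0, fun j hj => absurd hj (Fin.not_lt_zero j), hlt⟩
    · rcases (hb _ ⟨c, ⟨hc, heq.trans hb0⟩, rfl⟩).lt_or_eq with ⟨i, hi, hlt⟩ | h
      · refine le_of_lt ⟨i.succ, fun j hj => ?_, hlt⟩
        induction j using Fin.cases with
        | zero => exact heq
        | succ j => exact hi j (Fin.succ_lt_succ_iff.1 hj)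
      · have h' : Fin.tail c = Fin.tail b := h
        rw [← Fin.cons_self_tail c, ← Fin.cons_self_tail b, h', heq]

/-- `c` is the lexicographically largest among the nonnegative vectors with the same image
under `Φ`. -/
def IsLexOptimal {m : ℕ} {E : Type*} [AddCommGroup E] [Module ℝ E]
    (Φ : (Fin m → ℝ) →ₗ[ℝ] E) (c : Fin m → ℝ) : Prop :=
  0 ≤ c ∧ ∀ c', 0 ≤ c' → Φ c' = Φ c → toLex c' ≤ toLex c

section IsLexOptimal

variable {m : ℕ} {E : Type*} [AddCommGroup E] [Module ℝ E] {Φ : (Fin m → ℝ) →ₗ[ℝ] E}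

theorem IsLexOptimal.eq_of_map_eq {c c' : Fin m → ℝ} (hc : IsLexOptimal Φ c)
    (hc' : IsLexOptimal Φ c') (h : Φ c = Φ c') : c = c' :=
  toLex.injective (le_antisymm (hc'.2 c hc.1 h) (hc.2 c' hc'.1 h.symm))

/-- Optimality only depends on the support. -/
theorem IsLexOptimal.of_support {c c' : Fin m → ℝ} (hc : IsLexOptimal Φ c) (hc' : 0 ≤ c')
    (hsupp : ∀ i, c i = 0 → c' i = 0) : IsLexOptimal Φ c' := by
  refine ⟨hc', fun c'' hc'' hΦ => ?_⟩
  by_contra! hlt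
  have hev : ∀ᶠ ε in nhdsWithin (0 : ℝ) (Set.Ioi 0), ∀ i, 0 ≤ c i + ε * (c'' i - c' i) := by
    refine Filter.eventually_all.2 fun i => ?_
    rcases (hc.1 i).lt_or_eq with hpos | h0
    · have ht : Filter.Tendsto (fun ε : ℝ => c i + ε * (c'' i - c' i)) (nhds 0) (nhds (c i)) :=
        Continuous.tendsto' (by fun_prop) _ _ (by simp)
      exact ((ht.eventually (lt_mem_nhds hpos)).mono fun _ h => h.le).filter_mono
        nhdsWithin_le_nhds
    · filter_upwards [self_mem_nhdsWithin] with ε hε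
      rw [← h0, hsupp i h0.symm]
      simpa using mul_nonneg (le_of_lt hε) (hc'' i)
  obtain ⟨ε, hnonneg, hε⟩ := (hev.and self_mem_nhdsWithin).exists
  have hε : 0 < ε := hε
  have hle := hc.2 (c + ε • (c'' - c')) hnonneg (by simp [hΦ])
  refine hle.not_gt ?_
  obtain ⟨i, hi, hlt⟩ := hlt
  refine ⟨i, fun j hj => ?_, ?_⟩
  · have : c' j = c'' j := hi j hj
    simp [this]
  · have : c' i < c'' i := hlt
    simpa using mul_pos hε (sub_pos.2 this)

end IsLexOptimal

theorem Finset.card_piAntidiag_nat {ι : Type*} [DecidableEq ι] (s : Finset ι) (n : ℕ) :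
    (s.piAntidiag n).card = (s.card + n - 1).choose n := by
  rw [← card_finsuppAntidiag_nat_eq_choose]
  simp [finsuppAntidiag]

theorem exists_polynomial_eval_eq_card_piAntidiag {ι : Type*} [DecidableEq ι] (s : Finset ι)
    {h : ℕ} (hs : h ≤ s.card) : ∃ q : Polynomial ℝ, ∀ t : ℕ, 0 < t →
      ((if h ≤ t then (s.piAntidiag (t - h)).card else 0 : ℕ) : ℝ) = q.eval (t : ℝ) := by
  rcases hk : s.card with _ | k
  · refine ⟨0, fun t ht => ?_⟩
    obtain rfl : h = 0 := by omega
    simp [Finset.card_eq_zero.1 hk, ht.ne']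
  · refine ⟨Polynomial.C ((k.factorial : ℝ)⁻¹) *
      (descPochhammer ℝ k).comp (Polynomial.X + Polynomial.C ((k : ℝ) - h)), fun t ht => ?_⟩
    have hcast : (t : ℝ) + ((k : ℝ) - h) = ((t + k - h : ℕ) : ℝ) := by
      rw [Nat.cast_sub (by omega)]; push_cast; ring
    have hcard : (if h ≤ t then (s.piAntidiag (t - h)).card else 0) = (t + k - h).choose k := by
      split_ifs with hle
      · rw [Finset.card_piAntidiag_nat, hk, show k + 1 + (t - h) - 1 = k + (t - h) by omega,
          ← Nat.choose_symm_add, show t + k - h = k + (t - h) by omega]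
      · rw [Nat.choose_eq_zero_of_lt (by omega)]
    rw [hcard]
    simp only [Polynomial.eval_mul, Polynomial.eval_C, Polynomial.eval_comp, Polynomial.eval_add,
      Polynomial.eval_X]
    rw [hcast, descPochhammer_eval_eq_descFactorial, Nat.descFactorial_eq_factorial_mul_choose]
    have := Nat.factorial_ne_zero k
    push_cast
    field_simp

/-- A family of nonnegative vectors that is stable under integral translations preserving the
support is counted, by integral coordinate sum, by a polynomial. -/
theorem exists_polynomial_ncard_sum_eq {ι : Type*} [Fintype ι] {O : Set (ι → ℝ)}
    (hnonneg : ∀ c ∈ O, 0 ≤ c) (hsum : ∀ c ∈ O, ∃ t : ℕ, ∑ i, c i = t)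
    (hfin : ∀ t : ℕ, {c ∈ O | ∑ i, c i = t}.Finite)
    (hstable : ∀ c ∈ O, ∀ c', 0 ≤ c' → (∀ i, c i = 0 ↔ c' i = 0) →
      (∀ i, ∃ z : ℤ, c' i = c i + z) → c' ∈ O) :
    ∃ p : Polynomial ℝ, ∀ t : ℕ, 0 < t →
      (Set.ncard {c ∈ O | ∑ i, c i = t} : ℝ) = p.eval (t : ℝ) := by
  classical
  have hBfin : {r ∈ O | ∀ i, r i ≤ 1}.Finite := by
    refine ((Set.finite_Iic (Fintype.card ι)).biUnion fun t _ => hfin t).subset ?_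
    rintro r ⟨hrO, hr1⟩
    obtain ⟨t, ht⟩ := hsum r hrO
    refine Set.mem_biUnion (x := t) ?_ ⟨hrO, ht⟩
    have : ∑ i, r i ≤ ∑ _i : ι, (1 : ℝ) := Finset.sum_le_sum fun i _ => hr1 i
    rw [ht] at this
    simpa using this
  set B := hBfin.toFinset with hB
  have hBmem : ∀ r, r ∈ B ↔ r ∈ O ∧ ∀ i, r i ≤ 1 := fun r => by simp [hB]
  choose! h hh using hsum
  let supp : (ι → ℝ) → Finset ι := fun r => Finset.univ.filter fun i => r i ≠ 0
  have hq : ∀ r ∈ B, ∃ q : Polynomial ℝ, ∀ t : ℕ, 0 < t →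
      ((if h r ≤ t then ((supp r).piAntidiag (t - h r)).card else 0 : ℕ) : ℝ)
        = q.eval (t : ℝ) := by
    intro r hr
    rw [hBmem] at hr
    refine exists_polynomial_eval_eq_card_piAntidiag _ ?_
    have h1 : (h r : ℝ) ≤ (supp r).card := by
      rw [← hh r hr.1, ← Finset.sum_filter_ne_zero]
      refine (Finset.sum_le_card_nsmul _ _ 1 fun i _ => hr.2 i).trans ?_
      simp [supp]
    exact_mod_cast h1
  choose! q hq using hq
  let fl : (ι → ℝ) → ι → ℕ := fun c i => ⌈c i⌉₊ - 1
  let fr : (ι → ℝ) → ι → ℝ := fun c i => c i - (fl c i : ℝ)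
  have hfl0 : ∀ c i, c i = 0 → fl c i = 0 := fun c i hi => by simp [fl, hi]
  have hfr : ∀ c i, 0 ≤ c i → (c i = 0 ↔ fr c i = 0) ∧ 0 ≤ fr c i ∧ fr c i ≤ 1 := by
    intro c i hi
    rcases hi.eq_or_lt with h0 | hpos
    · simp [fr, hfl0 c i h0.symm, ← h0]
    · have h1 : 1 ≤ ⌈c i⌉₊ := Nat.one_le_ceil_iff.2 hpos
      have h2 : (fl c i : ℝ) = ⌈c i⌉₊ - 1 := by simp [fl, h1]
      have h3 := Nat.ceil_lt_add_one hi
      have h4 := Nat.le_ceil (c i)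
      simp only [fr, h2]
      refine ⟨⟨fun h => absurd h hpos.ne', fun h => ?_⟩, ?_, ?_⟩ <;> linarith
  have hadd : ∀ r ∈ B, ∀ k : ι → ℕ, (∀ i, k i ≠ 0 → i ∈ supp r) →
      (fun i => r i + (k i : ℝ)) ∈ O ∧ fl (fun i => r i + (k i : ℝ)) = k := by
    intro r hr k hk
    rw [hBmem] at hr
    have hk0 : ∀ i, r i = 0 → k i = 0 := fun i hi => by
      by_contra hki
      simpa [supp, hi] using hk i hki
    have hr0 := hnonneg r hr.1
    refine ⟨hstable r hr.1 _ (fun i => add_nonneg (hr0 i) (Nat.cast_nonneg _)) (fun i => ?_)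
      fun i => ⟨k i, by simp⟩, funext fun i => ?_⟩
    · refine ⟨fun hi => by simp [hi, hk0 i hi], fun hi => ?_⟩
      have := hr0 i
      have h2 : (0 : ℝ) ≤ k i := Nat.cast_nonneg _
      simp only [Pi.zero_apply] at this
      linarith
    · rcases (hr0 i).eq_or_lt with h0 | hpos
      · have h0 : r i = 0 := h0.symm
        simp [fl, h0, hk0 i h0]
      · have h1 : ⌈r i⌉₊ = 1 := by
          rw [Nat.ceil_eq_iff one_ne_zero]
          simpa using ⟨hpos, hr.2 i⟩
        simp [fl, Nat.ceil_add_natCast (hr0 i), h1]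
  refine ⟨∑ r ∈ B, q r, fun t ht => ?_⟩
  rw [Set.ncard_eq_toFinset_card _ (hfin t), Polynomial.eval_finsetSum,
    Finset.card_eq_sum_card_fiberwise (f := fr) (t := B), Nat.cast_sum]
  · refine Finset.sum_congr rfl fun r hr => ?_
    rw [← hq r hr t ht]
    congr 1
    have hr' := (hBmem r).1 hr
    split_ifs with hle
    · refine Finset.card_nbij' fl (fun k i => r i + (k i : ℝ)) ?_ ?_ ?_ ?_
      · intro c hc
        simp only [Finset.coe_filter, Set.Finite.mem_toFinset, Set.mem_ofPred_eq] at hc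
        obtain ⟨⟨hcO, hct⟩, rfl⟩ := hc
        have hs : ∀ i, fl c i ≠ 0 → i ∈ supp (fr c) := fun i hi => by
          simp only [supp, Finset.mem_filter, Finset.mem_univ, true_and]
          intro h0
          exact hi (hfl0 c i ((hfr c i (hnonneg c hcO i)).1.2 h0))
        simp only [Finset.mem_coe, Finset.mem_piAntidiag]
        refine ⟨?_, hs⟩
        rw [Finset.sum_subset (Finset.subset_univ _) fun i _ hi => by
          by_contra h0; exact hi (hs i h0)]
        have h1 := hh _ hr'.1
        simp only [fr, Finset.sum_sub_distrib, hct] at h1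
        have h2 : (t : ℝ) = ((∑ i, fl c i + h (fr c) : ℕ) : ℝ) := by
          push_cast; linarith
        have h3 : t = ∑ i, fl c i + h (fr c) := by exact_mod_cast h2
        exact (Nat.sub_eq_of_eq_add h3).symm
      · intro k hk
        simp only [Finset.mem_coe, Finset.mem_piAntidiag] at hk
        obtain ⟨hO, hfl⟩ := hadd r hr k hk.2
        simp only [Finset.coe_filter, Set.Finite.mem_toFinset, Set.mem_ofPred_eq]
        refine ⟨⟨hO, ?_⟩, ?_⟩
        · have h1 : ∑ i, k i = t - h r := by
            rw [← hk.1]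
            exact (Finset.sum_subset (Finset.subset_univ _) fun i _ hi => by
              by_contra h0; exact hi (hk.2 i h0)).symm
          rw [Finset.sum_add_distrib, hh r hr'.1, ← Nat.cast_sum, h1, Nat.cast_sub hle]
          ring
        · funext i
          simp only [fr, hfl]
          ring
      · intro c hc
        simp only [Finset.coe_filter, Set.mem_ofPred_eq] at hc
        rw [← hc.2]
        funext i
        simp [fr]
      · intro k hk
        simp only [Finset.mem_coe, Finset.mem_piAntidiag] at hk
        exact (hadd r hr k hk.2).2
    · rw [Finset.card_eq_zero, Finset.filter_eq_empty_iff]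
      rintro c hc rfl
      simp only [Set.Finite.mem_toFinset, Set.mem_ofPred_eq] at hc
      apply hle
      have h1 : (h (fr c) : ℝ) ≤ t := by
        rw [← hh _ hr'.1, ← hc.2]
        exact Finset.sum_le_sum fun i _ => sub_le_self _ (Nat.cast_nonneg _)
      exact_mod_cast h1
  · intro c hc
    simp only [Finset.mem_coe, Set.Finite.mem_toFinset, Set.mem_ofPred_eq] at hc
    have h0 := hnonneg c hc.1
    simp only [Finset.mem_coe, hBmem]
    refine ⟨hstable c hc.1 _ (fun i => (hfr c i (h0 i)).2.1) (fun i => (hfr c i (h0 i)).1)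
      fun i => ⟨-(fl c i : ℤ), ?_⟩, fun i => (hfr c i (h0 i)).2.2⟩
    simp [fr, sub_eq_add_neg]

theorem convexHull_range_eq_image_stdSimplex {ι E : Type*} [Fintype ι] [AddCommGroup E]
    [Module ℝ E] (v : ι → E) :
    convexHull ℝ (Set.range v) = Fintype.linearCombination ℝ v '' stdSimplex ℝ ι := by
  classical
  rw [← convexHull_basis_eq_stdSimplex, LinearMap.image_convexHull, ← Set.range_comp]
  congr 2
  funext i
  have : (fun j : ι => if i = j then (1 : ℝ) else 0) = Pi.single i 1 := by
    funext j; simp [Pi.single_apply, eq_comm]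
  simp [this, Fintype.linearCombination_apply_single]

theorem mem_smul_convexHull_range {ι E : Type*} [Fintype ι] [AddCommGroup E] [Module ℝ E]
    (v : ι → E) {t : ℝ} (ht : 0 < t) (x : E) :
    x ∈ t • convexHull ℝ (Set.range v) ↔
      ∃ c : ι → ℝ, 0 ≤ c ∧ ∑ i, c i = t ∧ Fintype.linearCombination ℝ v c = x := by
  rw [convexHull_range_eq_image_stdSimplex]
  constructor
  · rintro ⟨-, ⟨c, ⟨hc0, hc1⟩, rfl⟩, rfl⟩
    exact ⟨t • c, smul_nonneg ht.le hc0, by simp [← Finset.mul_sum, hc1], by simp⟩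
  · rintro ⟨c, hc0, hc1, rfl⟩
    refine ⟨_, ⟨t⁻¹ • c, ⟨smul_nonneg (inv_nonneg.2 ht.le) hc0, ?_⟩, rfl⟩, ?_⟩
    · simp [← Finset.mul_sum, hc1, ht.ne']
    · simp [smul_smul, ht.ne']

/-- The lattice points in the positive integer dilates of a lattice polytope are counted by a
polynomial. -/
theorem exists_polynomial_card_smul_convexHull {n m : ℕ} (w : Fin m → Fin n → ℤ) :
    ∃ p : Polynomial ℝ, ∀ t : ℕ, 0 < t →
      (Nat.card {x : Fin n → ℤ | (fun j => ((x j : ℤ) : ℝ)) ∈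
        (t : ℝ) • convexHull ℝ (Set.range fun i j => ((w i j : ℤ) : ℝ))} : ℝ) =
          p.eval (t : ℝ) := by
  set v : Fin m → Fin n → ℝ := fun i j => (w i j : ℝ) with hv
  set L := Fintype.linearCombination ℝ v with hL
  have hLapp : ∀ c j, L c j = ∑ i, c i * w i j := fun c j => by
    simp [hL, hv, Fintype.linearCombination_apply]
  let S : (Fin m → ℝ) →ₗ[ℝ] ℝ := ∑ i, LinearMap.proj i
  have hS : ∀ c, S c = ∑ i, c i := fun c => by simp [S]
  let cast : (Fin n → ℤ) → Fin n → ℝ := fun x j => (x j : ℝ)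
  have hcast : Function.Injective cast := fun x y h => funext fun j => by
    have := congrFun h j
    exact Int.cast_injective this
  let Φ := L.prod S
  have hΦ : ∀ {c c'}, Φ c = Φ c' ↔ L c = L c' ∧ ∑ i, c i = ∑ i, c' i := fun {c c'} => by
    simp [Φ, hS]
  let O : Set (Fin m → ℝ) :=
    {c | IsLexOptimal Φ c ∧ (∃ x, cast x = L c) ∧ ∃ t : ℕ, ∑ i, c i = t}
  have hinj : ∀ t : ℕ, Set.InjOn L {c ∈ O | ∑ i, c i = t} := fun t c hc c' hc' h =>
    hc.1.1.eq_of_map_eq hc'.1.1 (hΦ.2 ⟨h, hc.2.trans hc'.2.symm⟩)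
  have hfin : ∀ t : ℕ, {c ∈ O | ∑ i, c i = t}.Finite := by
    intro t
    refine Set.Finite.of_finite_image ?_ (hinj t)
    let N : Fin n → ℤ := fun j => t * ∑ i, |w i j|
    refine ((Set.finite_Icc (-N) N).image cast).subset ?_
    rintro - ⟨c, ⟨⟨hopt, ⟨x, hx⟩, -⟩, ht⟩, rfl⟩
    refine ⟨x, ?_, hx⟩
    have hbd : ∀ j, |x j| ≤ N j := by
      intro j
      have h1 : ((|x j| : ℤ) : ℝ) ≤ ((N j : ℤ) : ℝ) := by
        have h2 : (x j : ℝ) = ∑ i, c i * w i j := by rw [← hLapp, ← hx]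
        rw [Int.cast_abs, h2]
        simp only [N]
        push_cast
        rw [Finset.mul_sum]
        refine (Finset.abs_sum_le_sum_abs _ _).trans (Finset.sum_le_sum fun i _ => ?_)
        rw [abs_mul, abs_of_nonneg (hopt.1 i), ← ht]
        exact mul_le_mul_of_nonneg_right
          (Finset.single_le_sum (fun i _ => hopt.1 i) (Finset.mem_univ i)) (abs_nonneg _)
      exact_mod_cast h1
    exact ⟨fun j => (abs_le.1 (hbd j)).1, fun j => (abs_le.1 (hbd j)).2⟩
  obtain ⟨p, hp⟩ := exists_polynomial_ncard_sum_eq (O := O) (fun c hc => hc.1.1)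
    (fun c hc => hc.2.2) hfin (by
      rintro c ⟨hopt, ⟨x, hx⟩, t, ht⟩ c' hc' hsupp hz
      choose z hz using hz
      refine ⟨hopt.of_support hc' fun i => (hsupp i).1, ⟨fun j => x j + ∑ i, z i * w i j, ?_⟩, ?_⟩
      · funext j
        have h2 : (x j : ℝ) = ∑ i, c i * w i j := by rw [← hLapp, ← hx]
        simp [cast, hLapp, hz, h2, add_mul, Finset.sum_add_distrib]
      · have h1 : ∑ i, c' i = ((t + ∑ i, z i : ℤ) : ℝ) := by
          simp [hz, Finset.sum_add_distrib, ht]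
        have h2 : (0 : ℝ) ≤ ((t + ∑ i, z i : ℤ) : ℝ) := h1 ▸ Finset.sum_nonneg fun i _ => hc' i
        obtain ⟨s, hs⟩ := Int.eq_ofNat_of_zero_le (Int.cast_nonneg_iff.1 h2)
        exact ⟨s, by rw [h1, hs]; simp⟩)
  refine ⟨p, fun t ht => ?_⟩
  rw [← hp t ht, Nat.card_coe_set_eq, ← (hinj t).ncard_image,
    ← Set.ncard_image_of_injective _ hcast]
  congr 2
  ext y
  constructor
  · rintro ⟨x, hx, rfl⟩
    obtain ⟨c, hc0, hct, hcx⟩ := (mem_smul_convexHull_range v (Nat.cast_pos.2 ht) _).1 hx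
    have hcomp : IsCompact {c' : Fin m → ℝ | 0 ≤ c' ∧ Φ c' = Φ c} := by
      refine (isCompact_Icc (a := (0 : Fin m → ℝ)) (b := fun _ => (t : ℝ))).of_isClosed_subset ?_ ?_
      · exact isClosed_Ici.inter
          (isClosed_eq (LinearMap.continuous_of_finiteDimensional Φ) continuous_const)
      · rintro c' ⟨h0, h⟩
        refine ⟨h0, fun i => ?_⟩
        rw [← hct, ← (hΦ.1 h).2]
        exact Finset.single_le_sum (fun i _ => h0 i) (Finset.mem_univ i)
    obtain ⟨b, ⟨hb0, hb⟩, hmax⟩ := hcomp.exists_toLex_max ⟨c, hc0, rfl⟩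
    have hb' := hΦ.1 hb
    refine ⟨b, ⟨⟨⟨hb0, fun c' h0 h => hmax c' ⟨h0, h.trans hb⟩⟩, ⟨x, ?_⟩, t, ?_⟩, ?_⟩, ?_⟩
    · exact hcx.symm.trans hb'.1.symm
    · exact hb'.2.trans hct
    · exact hb'.2.trans hct
    · exact hb'.1.trans hcx
  · rintro ⟨c, ⟨⟨hopt, ⟨x, hx⟩, -⟩, hct⟩, rfl⟩
    exact ⟨x, (mem_smul_convexHull_range v (Nat.cast_pos.2 ht) _).2 ⟨c, hopt.1, hct, hx.symm⟩, hx⟩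

theorem Polynomial.degree_eq_and_leadingCoeff_eq_of_tendsto {p : Polynomial ℝ} {n : ℕ} {a : ℝ}
    (ha : a ≠ 0)
    (h : Filter.Tendsto (fun t : ℕ => p.eval (t : ℝ) / (t : ℝ) ^ n) Filter.atTop (nhds a)) :
    p.degree = n ∧ p.leadingCoeff = a := by
  have hX : (fun t : ℕ => p.eval (t : ℝ) / (t : ℝ) ^ n) =
      (fun x : ℝ => p.eval x / (Polynomial.X ^ n : Polynomial ℝ).eval x) ∘ Nat.cast := by
    funext t; simp
  rw [hX] at h
  have hcast := tendsto_natCast_atTop_atTop (R := ℝ)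
  have hdeg : (Polynomial.X ^ n : Polynomial ℝ).degree = n := Polynomial.degree_X_pow n
  rcases lt_trichotomy p.degree n with hlt | heq | hgt
  · exact absurd (tendsto_nhds_unique h
      ((p.div_tendsto_atTop_zero_of_degree_lt _ (hdeg ▸ hlt)).comp hcast)) ha
  · refine ⟨heq, ?_⟩
    have := (p.div_tendsto_atTop_leadingCoeff_div_of_degree_eq _ (heq.trans hdeg.symm)).comp hcast
    simpa using tendsto_nhds_unique this h
  · have := (p.abs_div_tendsto_atTop_atTop_of_degree_gt _ (hdeg ▸ hgt)
      (Polynomial.monic_X_pow n).ne_zero).comp hcast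
    exact absurd h.abs (not_tendsto_nhds_of_tendsto_atTop this _)

theorem card_inter_smul_span_basisFun {n : ℕ} (P : Set (Fin n → ℝ)) {t : ℝ} (ht : t ≠ 0) :
    Nat.card ↑(P ∩ t⁻¹ • (Submodule.span ℤ (Set.range (Pi.basisFun ℝ (Fin n))) :
      Set (Fin n → ℝ))) =
    Nat.card {x : Fin n → ℤ | (fun i => ((x i : ℤ) : ℝ)) ∈ t • P} := by
  let cast : (Fin n → ℤ) → Fin n → ℝ := fun x j => (x j : ℝ)
  have hcast : Function.Injective fun x => t⁻¹ • cast x := fun x y h => funext fun j => by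
    have := congrFun (smul_right_injective _ (inv_ne_zero ht) h) j
    exact Int.cast_injective this
  rw [Nat.card_coe_set_eq, Nat.card_coe_set_eq, ← Set.ncard_image_of_injective _ hcast]
  congr 1
  ext y
  simp only [Set.mem_inter_iff, Set.mem_inv_smul_set_iff₀ ht, SetLike.mem_coe,
    (Pi.basisFun ℝ (Fin n)).mem_span_iff_repr_mem ℤ, Pi.basisFun_repr, Set.mem_image,
    Set.mem_ofPred_eq]
  constructor
  · rintro ⟨hy, h⟩
    choose x hx using h
    have hx' : cast x = t • y := funext hx
    refine ⟨x, ?_, by rw [hx', inv_smul_smul₀ ht]⟩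
    change cast x ∈ _
    rw [hx']
    exact Set.smul_mem_smul_set hy
  · rintro ⟨x, hx, rfl⟩
    refine ⟨(Set.mem_smul_set_iff_inv_smul_mem₀ ht _ _).1 hx, fun i => ⟨x i, ?_⟩⟩
    rw [smul_inv_smul₀ ht]
    rfl

/-- **Ehrhart's theorem** for full-dimensional lattice polytopes: the lattice-point
counting function `t ↦ #(tP ∩ ℤ^n)` is a genuine polynomial of degree `n` whose leading
coefficient equals the volume of `P`. -/
theorem ehrhart_lattice_polytope (n : ℕ) (V : Finset (Fin n → ℤ))
    (P : Set (Fin n → ℝ))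
    (hP : P = convexHull ℝ ((fun v : Fin n → ℤ => fun i => ((v i : ℤ) : ℝ)) '' (V : Set (Fin n → ℤ))))
    (hfull : affineSpan ℝ P = ⊤) :
    ∃ p : Polynomial ℝ, p.degree = (n : ℕ) ∧ p.leadingCoeff = (volume P).toReal ∧
      ∀ t : ℕ, 0 < t →
        (Nat.card {x : Fin n → ℤ | (fun i => ((x i : ℤ) : ℝ)) ∈ (t : ℝ) • P} : ℝ) =
          p.eval (t : ℝ) := by
  have hrange : ((fun v : Fin n → ℤ => fun i => ((v i : ℤ) : ℝ)) '' (V : Set (Fin n → ℤ))) =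
      Set.range fun i j => (((V.equivFin.symm i : Fin n → ℤ) j : ℤ) : ℝ) := by
    ext y
    constructor
    · rintro ⟨x, hx, rfl⟩
      exact ⟨V.equivFin ⟨x, hx⟩, by simp⟩
    · rintro ⟨i, rfl⟩
      exact ⟨_, (V.equivFin.symm i).2, rfl⟩
  obtain ⟨p, hp⟩ := exists_polynomial_card_smul_convexHull
    fun i => (V.equivFin.symm i : Fin n → ℤ)
  rw [← hrange, ← hP] at hp
  have hcompact : IsCompact P := hP ▸ (V.finite_toSet.image _).isCompact_convexHull (𝕜 := ℝ)
  have hconvex : Convex ℝ P := hP ▸ convex_convexHull ℝ _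
  have hvol : (volume P).toReal ≠ 0 := by
    refine ENNReal.toReal_ne_zero.2 ⟨?_, hcompact.measure_lt_top.ne⟩
    exact (Measure.measure_pos_of_nonempty_interior _
      (hconvex.interior_nonempty_iff_affineSpan_eq_top.2 hfull)).ne'
  have hlim := tendsto_card_div_pow_atTop_volume P hcompact.isBounded hcompact.measurableSet
    (hconvex.addHaar_frontier volume)
  rw [Fintype.card_fin] at hlim
  have hdeg := Polynomial.degree_eq_and_leadingCoeff_eq_of_tendsto hvol (p := p)
    (hlim.congr' <| (Filter.eventually_gt_atTop 0).mono fun t ht => by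
      rw [card_inter_smul_span_basisFun P (Nat.cast_ne_zero.2 ht.ne'), hp t ht])
  exact ⟨p, hdeg.1, hdeg.2, hp⟩
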